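/- Let K be a field, R = K[x_1,...,x_n], d a positive integer, α: R → R the K-algebra map with α(x_i) = x_i^d, and I a homogeneous ideal with I' = α(I)R. Let p be the largest integer i with reg(I) = t_i(I) − i, where t_i(I) = max{ j : β_{i,j}(I) ≠ 0 }. Then reg(I') ≥ d·reg(I) + p(d−1). -/

import Mathlib

open MvPolynomial

variable {K : Type} [Field K]

/-- The degree-`k` homogeneous component of a homogeneous ideal `I`,
as a `K`-vector subspace of the polynomial ring (zero in negative degrees). -/
noncomputable def idealPiece {n : ℕ} (I : Ideal (MvPolynomial (Fin n) K)) (k : ℤ) :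
    Submodule K (MvPolynomial (Fin n) K) :=
  if 0 ≤ k then
    (Submodule.restrictScalars K (I : Submodule (MvPolynomial (Fin n) K) (MvPolynomial (Fin n) K)))
      ⊓ (homogeneousSubmodule (Fin n) K k.toNat)
  else ⊥

lemma mul_X_mem_idealPiece {n : ℕ} (I : Ideal (MvPolynomial (Fin n) K)) (t : Fin n) (k : ℤ)
    {x : MvPolynomial (Fin n) K} (hx : x ∈ idealPiece I k) :
    (X t : MvPolynomial (Fin n) K) * x ∈ idealPiece I (k + 1) := by
  by_cases h : 0 ≤ k
  · rw [idealPiece, if_pos h] at hx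
    rw [idealPiece, if_pos (by omega)]
    refine ⟨I.mul_mem_left _ hx.1, ?_⟩
    rw [Submodule.mem_inf] at hx
    have hh : x.IsHomogeneous k.toNat := (mem_homogeneousSubmodule _ _).1 hx.2
    have : ((X t : MvPolynomial (Fin n) K) * x).IsHomogeneous (1 + k.toNat) :=
      (isHomogeneous_X K t).mul hh
    have he : (k + 1).toNat = 1 + k.toNat := by omega
    exact (mem_homogeneousSubmodule _ _).2 (he ▸ this)
  · rw [idealPiece, if_neg h, Submodule.mem_bot] at hx
    rw [hx, mul_zero]
    exact Submodule.zero_mem _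

/-- Multiplication by the variable `X t` as a linear map between graded pieces. -/
noncomputable def mulXPiece {n : ℕ} (I : Ideal (MvPolynomial (Fin n) K)) (t : Fin n) (k : ℤ) :
    idealPiece I k →ₗ[K] idealPiece I (k + 1) :=
  (LinearMap.mulLeft K (X t)).restrict (fun _ hx => mul_X_mem_idealPiece I t k hx)

/-- Index set of the `i`-th term of the Koszul complex: subsets of the variables of size `i`. -/
abbrev KoszulIdx (n i : ℕ) := {s : Finset (Fin n) // s.card = i}

/-- The Koszul differential (in internal degree `j`) of the complex computing
`Tor(I, K)`, from homological degree `i+1` to homological degree `i`. -/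
noncomputable def koszulDiff {n : ℕ} (I : Ideal (MvPolynomial (Fin n) K)) (i : ℕ) (j : ℤ) :
    ((KoszulIdx n (i + 1)) → idealPiece I (j - (i + 1 : ℕ)))
      →ₗ[K] ((KoszulIdx n i) → idealPiece I (j - (i : ℕ))) :=
  ∑ s' : KoszulIdx n (i + 1), ∑ t ∈ (s' : Finset (Fin n)).attach,
    ((-1 : K) ^ (((s' : Finset (Fin n)).filter (fun u => u < t.1)).card)) •
      ((LinearMap.single (R := K) (φ := fun _ : KoszulIdx n i => idealPiece I (j - (i : ℕ)))
          ⟨(s' : Finset (Fin n)).erase t.1, by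
            rw [Finset.card_erase_of_mem t.2, s'.2]; rfl⟩) ∘ₗ
        (LinearEquiv.ofEq _ _ (by rw [show j - ((i : ℕ) + 1 : ℕ) + 1 = j - (i : ℕ) by push_cast; ring])).toLinearMap ∘ₗ
        (mulXPiece I t.1 (j - ((i : ℕ) + 1 : ℕ))) ∘ₗ
        (LinearMap.proj s'))

/-- Cycles of the Koszul complex at homological degree `i`, internal degree `j`. -/
noncomputable def koszulCycles {n : ℕ} (I : Ideal (MvPolynomial (Fin n) K)) :
    (i : ℕ) → (j : ℤ) → Submodule K ((KoszulIdx n i) → idealPiece I (j - (i : ℕ)))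
  | 0, _ => ⊤
  | (i + 1), j => LinearMap.ker (koszulDiff I i j)

set_option synthInstance.maxHeartbeats 1000000 in
set_option maxHeartbeats 1000000 in
/-- The graded Betti number `β_{i,j}(I) = dim_K Tor_i(I, K)_j`, computed as the dimension
of the homology of the Koszul complex (all spaces involved are finite-dimensional, so the
dimension of the homology `Z/B` is `dim Z - dim (B ⊓ Z)`). -/
noncomputable def gradedBetti {n : ℕ} (I : Ideal (MvPolynomial (Fin n) K)) (i : ℕ) (j : ℤ) : ℕ :=
  Module.finrank K ↥(koszulCycles I i j) -
    Module.finrank K ↥(LinearMap.range (koszulDiff I i j) ⊓ koszulCycles I i j)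

/-- The Castelnuovo–Mumford regularity `reg(I) = max { j - i : β_{i,j}(I) ≠ 0 }`. -/
noncomputable def reg {n : ℕ} (I : Ideal (MvPolynomial (Fin n) K)) : ℤ :=
  sSup {r : ℤ | ∃ (i : ℕ) (j : ℤ), gradedBetti I i j ≠ 0 ∧ r = j - i}

/-- `t_i(I) = max { j : β_{i,j}(I) ≠ 0 }`, the maximal shift in homological degree `i`. -/
noncomputable def maxShift {n : ℕ} (I : Ideal (MvPolynomial (Fin n) K)) (i : ℕ) : ℤ :=
  sSup {j : ℤ | gradedBetti I i j ≠ 0}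

/-- The projective dimension of `I`. -/
noncomputable def projdim {n : ℕ} (I : Ideal (MvPolynomial (Fin n) K)) : ℕ :=
  sSup {i : ℕ | ∃ j : ℤ, gradedBetti I i j ≠ 0}

/-- An ideal of a polynomial ring is homogeneous (for the standard grading) if it contains
all homogeneous components of its elements. -/
def IsHomogeneousIdeal {n : ℕ} (I : Ideal (MvPolynomial (Fin n) K)) : Prop :=
  ∀ f ∈ I, ∀ k : ℕ, homogeneousComponent k f ∈ I

/-- The sign `(-1) ^ #{u ∈ s | u < t}` of the Koszul differential. -/
noncomputable def koszulSign {n : ℕ} (s : Finset (Fin n)) (t : Fin n) : MvPolynomial (Fin n) K :=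
  (-1) ^ (s.filter (· < t)).card

/-- The Koszul differential on all cochains `Finset (Fin n) → K[x]`, disregarding gradings. -/
noncomputable def fullKoszulDiff {n : ℕ} (z : Finset (Fin n) → MvPolynomial (Fin n) K)
    (s : Finset (Fin n)) : MvPolynomial (Fin n) K :=
  ∑ t ∈ sᶜ, koszulSign s t * (X t * z (insert t s))

/-- Extension by zero of a Koszul chain of homological degree `i`. -/
noncomputable def extendChain {n : ℕ} {I : Ideal (MvPolynomial (Fin n) K)} {i : ℕ} {k : ℤ}
    (z : KoszulIdx n i → idealPiece I k) (s : Finset (Fin n)) : MvPolynomial (Fin n) K :=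
  if h : s.card = i then z ⟨s, h⟩ else 0

lemma neg_one_pow_smul_eq {n : ℕ} (m : ℕ) (x : MvPolynomial (Fin n) K) :
    ((-1 : K) ^ m) • x = (-1) ^ m * x := by
  rcases neg_one_pow_eq_or K m with h | h <;>
  rcases Nat.even_or_odd m with h' | h' <;> simp [h'.neg_one_pow]

lemma koszulDiff_apply_coe {n : ℕ} (I : Ideal (MvPolynomial (Fin n) K)) (i : ℕ) (j : ℤ)
    (w : KoszulIdx n (i + 1) → idealPiece I (j - (i + 1 : ℕ))) (s : KoszulIdx n i) :
    ((koszulDiff I i j w s : idealPiece I (j - (i : ℕ))) : MvPolynomial (Fin n) K) =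
      fullKoszulDiff (extendChain w) s := by
  classical
  have key : ((koszulDiff I i j w s : idealPiece I (j - (i : ℕ))) : MvPolynomial (Fin n) K) =
      ∑ s' : KoszulIdx n (i + 1), ∑ t ∈ (s' : Finset (Fin n)),
        if s'.1.erase t = s.1 then koszulSign s'.1 t * (X t * extendChain w s'.1) else 0 := by
    rw [koszulDiff]
    simp only [LinearMap.sum_apply, Finset.sum_apply, AddSubmonoidClass.coe_finsetSum]
    refine Finset.sum_congr rfl fun s' _ => ?_
    rw [← Finset.sum_attach s'.1]
    refine Finset.sum_congr rfl fun t _ => ?_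
    simp only [LinearMap.smul_apply, LinearMap.comp_apply, Pi.smul_apply, SetLike.val_smul,
      neg_one_pow_smul_eq, LinearMap.single_apply, Pi.single_apply]
    have hs' : extendChain w s'.1 = (w s' : MvPolynomial (Fin n) K) := by
      simp [extendChain, s'.2]
    by_cases h : s'.1.erase t.1 = s.1
    · have h2 : s = ⟨s'.1.erase t.1, by rw [h]; exact s.2⟩ := Subtype.ext h.symm
      rw [if_pos h, if_pos h2, hs']
      rfl
    · have h2 : s ≠ ⟨s'.1.erase t.1, by
          rw [Finset.card_erase_of_mem t.2, s'.2]; rfl⟩ := fun e => h (congrArg Subtype.val e).symm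
      rw [if_neg h, if_neg h2]
      simp
  rw [key, fullKoszulDiff]
  have hsub : ∀ G : Finset (Fin n) → MvPolynomial (Fin n) K,
      ∑ s' : KoszulIdx n (i + 1), G s'.1 = ∑ s' with s'.card = i + 1, G s' := fun G =>
    (Finset.sum_subtype (Finset.univ.filter fun s' : Finset (Fin n) => s'.card = i + 1)
      (by simp) G).symm
  rw [hsub (fun s' => ∑ t ∈ s',
        if s'.erase t = s.1 then koszulSign s' t * (X t * extendChain w s') else 0)]
  rw [Finset.sum_sigma']
  symm
  refine Finset.sum_of_injOn (fun t => ⟨insert t s.1, t⟩) ?_ ?_ ?_ ?_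
  · intro a _ b _ h
    simp only [Sigma.mk.injEq, heq_eq_eq] at h
    exact h.2
  · intro t ht
    simp only [Finset.coe_compl, Set.mem_compl_iff, Finset.mem_coe] at ht
    simp [Finset.card_insert_of_notMem ht, s.2]
  · rintro ⟨s', t⟩ h1 h2
    simp only [Finset.mem_sigma, Finset.mem_filter, Finset.mem_univ, true_and] at h1
    refine if_neg fun h => h2 ⟨t, ?_, ?_⟩
    · simp [← h]
    · simp [← h, Finset.insert_erase h1.2]
  · intro t ht
    rw [Finset.mem_compl] at ht
    simp only [Finset.erase_insert ht, if_true]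
    rw [koszulSign, koszulSign, Finset.filter_insert, if_neg (lt_irrefl t)]

lemma mem_idealPiece_iff {n : ℕ} {I : Ideal (MvPolynomial (Fin n) K)} {k : ℤ}
    {f : MvPolynomial (Fin n) K} :
    f ∈ idealPiece I k ↔ f ∈ I ∧ ∀ b, coeff b f ≠ 0 → (b.degree : ℤ) = k := by
  rw [idealPiece]
  split_ifs with hk
  · rw [Submodule.mem_inf, Submodule.restrictScalars_mem, mem_homogeneousSubmodule]
    refine and_congr_right fun _ => ⟨fun h b hb => ?_, fun h b hb => ?_⟩
    · have := h.coeff_eq_zero.mt hb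
      omega
    · have := h b hb
      rw [show Finsupp.weight 1 b = b.degree from
        (DFunLike.congr_fun Finsupp.degree_eq_weight_one b).symm]
      omega
  · rw [Submodule.mem_bot]
    constructor
    · rintro rfl
      simp
    · rintro ⟨-, h⟩
      ext b
      by_contra hb
      have := h b (by simpa using hb)
      omega

instance finiteDimensional_idealPiece {n : ℕ} (I : Ideal (MvPolynomial (Fin n) K)) (k : ℤ) :
    FiniteDimensional K (idealPiece I k) := by
  have : FiniteDimensional K (homogeneousSubmodule (Fin n) K k.toNat) :=
    Module.Finite.iff_fg.2 (homogeneousSubmodule_fg _ _ _)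
  refine Submodule.finiteDimensional_of_le (S₂ := homogeneousSubmodule (Fin n) K k.toNat) ?_
  rw [idealPiece]
  split_ifs
  · exact inf_le_right
  · exact bot_le

lemma extendChain_apply {n : ℕ} {I : Ideal (MvPolynomial (Fin n) K)} {i : ℕ} {k : ℤ}
    (z : KoszulIdx n i → idealPiece I k) (s : KoszulIdx n i) :
    extendChain z s.1 = z s := by
  simp [extendChain, s.2]

lemma extendChain_mem {n : ℕ} {I : Ideal (MvPolynomial (Fin n) K)} {i : ℕ} {k : ℤ}
    (z : KoszulIdx n i → idealPiece I k) (s : Finset (Fin n)) :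
    extendChain z s ∈ idealPiece I k := by
  rw [extendChain]
  split_ifs
  · exact (z _).2
  · exact Submodule.zero_mem _

lemma fullKoszulDiff_extendChain_of_card_ne {n : ℕ} {I : Ideal (MvPolynomial (Fin n) K)} {i : ℕ}
    {k : ℤ} (z : KoszulIdx n i → idealPiece I k) {s : Finset (Fin n)} (hs : s.card + 1 ≠ i) :
    fullKoszulDiff (extendChain z) s = 0 := by
  refine Finset.sum_eq_zero fun t ht => ?_
  rw [Finset.mem_compl] at ht
  rw [extendChain, dif_neg (by rwa [Finset.card_insert_of_notMem ht])]
  simp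

lemma mem_koszulCycles_iff {n : ℕ} {I : Ideal (MvPolynomial (Fin n) K)} {i : ℕ} {j : ℤ}
    {z : KoszulIdx n i → idealPiece I (j - (i : ℕ))} :
    z ∈ koszulCycles I i j ↔ fullKoszulDiff (extendChain z) = 0 := by
  cases i with
  | zero =>
    refine ⟨fun _ => ?_, fun _ => Submodule.mem_top⟩
    ext1 s
    exact fullKoszulDiff_extendChain_of_card_ne z (by omega)
  | succ i =>
    rw [koszulCycles, LinearMap.mem_ker]
    constructor
    · intro h
      ext1 s
      by_cases hs : s.card = i
      · have := koszulDiff_apply_coe I i j z ⟨s, hs⟩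
        rw [h] at this
        exact this.symm
      · exact fullKoszulDiff_extendChain_of_card_ne z (by omega)
    · intro h
      ext1 s
      apply Subtype.ext
      rw [koszulDiff_apply_coe, h]
      rfl

lemma mem_range_koszulDiff_iff {n : ℕ} {I : Ideal (MvPolynomial (Fin n) K)} {i : ℕ} {j : ℤ}
    {z : KoszulIdx n i → idealPiece I (j - (i : ℕ))} :
    z ∈ LinearMap.range (koszulDiff I i j) ↔
      ∃ w : Finset (Fin n) → MvPolynomial (Fin n) K,
        (∀ s, s.card = i + 1 → w s ∈ idealPiece I (j - (i + 1 : ℕ))) ∧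
        ∀ s, s.card = i → fullKoszulDiff w s = extendChain z s := by
  rw [LinearMap.mem_range]
  constructor
  · rintro ⟨w, rfl⟩
    refine ⟨extendChain w, fun s _ => extendChain_mem w s, fun s hs => ?_⟩
    rw [extendChain_apply _ ⟨s, hs⟩, koszulDiff_apply_coe]
  · rintro ⟨w, hw, h⟩
    refine ⟨fun s => ⟨w s.1, hw _ s.2⟩, ?_⟩
    ext1 s
    apply Subtype.ext
    rw [koszulDiff_apply_coe, ← extendChain_apply z, ← h _ s.2]
    refine Finset.sum_congr rfl fun t ht => ?_
    rw [Finset.mem_compl] at ht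
    rw [extendChain, dif_pos (by rw [Finset.card_insert_of_notMem ht, s.2])]

lemma gradedBetti_ne_zero_iff {n : ℕ} {I : Ideal (MvPolynomial (Fin n) K)} {i : ℕ} {j : ℤ} :
    gradedBetti I i j ≠ 0 ↔ ∃ z ∈ koszulCycles I i j, z ∉ LinearMap.range (koszulDiff I i j) := by
  rw [gradedBetti]
  constructor
  · intro h
    by_contra! hc
    exact h (by rw [inf_eq_right.2 hc, Nat.sub_self])
  · rintro ⟨z, hz, hzr⟩
    have hlt : LinearMap.range (koszulDiff I i j) ⊓ koszulCycles I i j < koszulCycles I i j :=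
      inf_lt_right.2 fun hle => hzr (hle hz)
    have := Submodule.finrank_lt_finrank_of_lt hlt
    omega

/-- The exponent vector `(d - 1) ∑_{t ∈ s} e_t`. -/
noncomputable def subsetExponent {n : ℕ} (d : ℕ) (s : Finset (Fin n)) : Fin n →₀ ℕ :=
  (d - 1) • ∑ t ∈ s, Finsupp.single t 1

lemma subsetExponent_apply {n : ℕ} (d : ℕ) (s : Finset (Fin n)) (u : Fin n) :
    subsetExponent d s u = if u ∈ s then d - 1 else 0 := by
  simp [subsetExponent, Finsupp.single_apply]

lemma degree_subsetExponent {n : ℕ} (d : ℕ) (s : Finset (Fin n)) :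
    (subsetExponent d s).degree = (d - 1) * s.card := by
  simp [subsetExponent]

lemma smul_add_right_injective {n d : ℕ} (hd : 0 < d) (e : Fin n →₀ ℕ) :
    Function.Injective fun c : Fin n →₀ ℕ => d • c + e := by
  intro a b h
  ext t
  have := DFunLike.congr_fun (add_right_cancel h) t
  simpa [hd.ne'] using this

/-- The `K`-linear map sending `x ^ (d • c + (d - 1) 1_s)` to `x ^ c` and all other monomials
to zero. -/
noncomputable def contractAt {n d : ℕ} (hd : 0 < d) (s : Finset (Fin n))
    (g : MvPolynomial (Fin n) K) : MvPolynomial (Fin n) K :=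
  AddMonoidAlgebra.comapDomain (fun c : Fin n →₀ ℕ => d • c + subsetExponent d s)
    (smul_add_right_injective hd _) g

section contractAt

variable {n d : ℕ} (hd : 0 < d) (s : Finset (Fin n))

lemma coeff_contractAt (g : MvPolynomial (Fin n) K) (c : Fin n →₀ ℕ) :
    coeff c (contractAt hd s g) = coeff (d • c + subsetExponent d s) g :=
  rfl

lemma contractAt_zero : contractAt hd s (0 : MvPolynomial (Fin n) K) = 0 := by
  ext c
  simp [coeff_contractAt]

lemma contractAt_add (g h : MvPolynomial (Fin n) K) :
    contractAt hd s (g + h) = contractAt hd s g + contractAt hd s h := by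
  ext c
  simp [coeff_contractAt]

lemma contractAt_sum {ι : Type*} (S : Finset ι) (g : ι → MvPolynomial (Fin n) K) :
    contractAt hd s (∑ i ∈ S, g i) = ∑ i ∈ S, contractAt hd s (g i) := by
  ext c
  simp [coeff_contractAt, coeff_sum]

lemma contractAt_C_mul (a : K) (g : MvPolynomial (Fin n) K) :
    contractAt hd s (C a * g) = C a * contractAt hd s g := by
  ext c
  simp [coeff_contractAt]

lemma contractAt_koszulSign_mul (s' : Finset (Fin n)) (t : Fin n) (g : MvPolynomial (Fin n) K) :
    contractAt hd s (koszulSign s' t * g) = koszulSign s' t * contractAt hd s g := by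
  have : (koszulSign s' t : MvPolynomial (Fin n) K) =
      C ((-1) ^ (s'.filter (· < t)).card) := by simp [koszulSign]
  rw [this, contractAt_C_mul]

lemma contractAt_mul_X_pow (g : MvPolynomial (Fin n) K) (t : Fin n) :
    contractAt hd s (g * X t ^ d) = contractAt hd s g * X t := by
  ext c
  rw [coeff_contractAt, X_pow_eq_monomial, coeff_mul_monomial', coeff_mul_X', coeff_contractAt,
    mul_one]
  simp only [Finsupp.single_le_iff, Finsupp.mem_support_iff]
  by_cases hc : c t = 0
  · rw [if_neg, if_neg (by simpa using hc)]
    simp only [Finsupp.add_apply, Finsupp.smul_apply, hc, subsetExponent_apply, smul_eq_mul]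
    split_ifs <;> omega
  · have hle : d ≤ d * c t := Nat.le_mul_of_pos_right d (by omega)
    rw [if_pos, if_pos hc]
    · congr 1
      ext u
      by_cases hu : t = u
      · subst hu
        simp only [Finsupp.coe_tsub, Pi.sub_apply, Finsupp.add_apply, Finsupp.smul_apply,
          Finsupp.single_eq_same, smul_eq_mul, Nat.mul_sub]
        omega
      · simp [hu]
    · simp only [Finsupp.add_apply, Finsupp.smul_apply, smul_eq_mul]
      omega

lemma contractAt_mul_aeval (g f : MvPolynomial (Fin n) K) :
    contractAt hd s (g * aeval (fun i => (X i : MvPolynomial (Fin n) K) ^ d) f) =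
      contractAt hd s g * f := by
  induction f using MvPolynomial.induction_on with
  | C a => rw [aeval_C, algebraMap_eq, mul_comm, contractAt_C_mul, mul_comm]
  | add p q hp hq => rw [map_add, mul_add, contractAt_add, hp, hq, mul_add]
  | mul_X p t hp => rw [map_mul, aeval_X, ← mul_assoc, contractAt_mul_X_pow, hp, mul_assoc]

lemma contractAt_X_mul {t : Fin n} (ht : t ∉ s) (g : MvPolynomial (Fin n) K) :
    contractAt hd s (X t * g) = X t * contractAt hd (insert t s) g := by
  ext c
  rw [coeff_contractAt, coeff_X_mul', coeff_X_mul', coeff_contractAt]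
  simp only [Finsupp.mem_support_iff, Finsupp.add_apply, Finsupp.smul_apply, subsetExponent_apply,
    if_neg ht, smul_eq_mul, add_zero, mul_ne_zero_iff]
  by_cases hc : c t = 0
  · simp [hc]
  · have hle : d ≤ d * c t := Nat.le_mul_of_pos_right d (by omega)
    rw [if_pos ⟨hd.ne', hc⟩, if_pos hc]
    congr 1
    ext u
    by_cases hu : t = u
    · subst hu
      simp only [Finsupp.coe_tsub, Pi.sub_apply, Finsupp.add_apply, Finsupp.smul_apply,
        Finsupp.single_eq_same, smul_eq_mul, Nat.mul_sub, subsetExponent_apply, if_neg ht,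
        Finset.mem_insert_self, if_true]
      omega
    · simp [subsetExponent_apply, Ne.symm hu]

lemma contractAt_monomial_subsetExponent :
    contractAt hd s (monomial (subsetExponent d s) (1 : K)) = 1 := by
  ext c
  rw [coeff_contractAt, coeff_monomial, coeff_one]
  refine if_congr ?_ rfl rfl
  rw [right_eq_add]
  simp [hd.ne', eq_comm]

lemma contractAt_mem {I : Ideal (MvPolynomial (Fin n) K)} {g : MvPolynomial (Fin n) K}
    (hg : g ∈ I.map (aeval (fun i => (X i : MvPolynomial (Fin n) K) ^ d) :
      MvPolynomial (Fin n) K →ₐ[K] MvPolynomial (Fin n) K)) :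
    contractAt hd s g ∈ I := by
  suffices h : ∀ h, contractAt hd s (h * g) ∈ I by simpa using h 1
  refine Submodule.span_induction (p := fun g _ => ∀ h, contractAt hd s (h * g) ∈ I)
    ?_ ?_ ?_ ?_ hg
  · rintro _ ⟨f, hf, rfl⟩ h
    exact (contractAt_mul_aeval hd s h f).symm ▸ I.mul_mem_left _ hf
  · intro h
    rw [mul_zero, contractAt_zero]
    exact I.zero_mem
  · intro x y _ _ hx hy h
    rw [mul_add, contractAt_add]
    exact I.add_mem (hx h) (hy h)
  · intro a x _ hx h
    rw [smul_eq_mul, ← mul_assoc]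
    exact hx _

lemma contractAt_mem_idealPiece {I : Ideal (MvPolynomial (Fin n) K)} {g : MvPolynomial (Fin n) K}
    {j : ℤ} (hg : g ∈ idealPiece (I.map (aeval (fun i => (X i : MvPolynomial (Fin n) K) ^ d) :
      MvPolynomial (Fin n) K →ₐ[K] MvPolynomial (Fin n) K)) (d * j - s.card)) :
    contractAt hd s g ∈ idealPiece I (j - s.card) := by
  rw [mem_idealPiece_iff] at hg ⊢
  refine ⟨contractAt_mem hd s hg.1, fun c hc => ?_⟩
  have h := hg.2 _ hc
  rw [map_add, map_nsmul, degree_subsetExponent] at h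
  push_cast [Nat.cast_sub hd, smul_eq_mul] at h
  have hd' : (d : ℤ) ≠ 0 := by exact_mod_cast hd.ne'
  apply mul_left_cancel₀ hd'
  linear_combination h

lemma fullKoszulDiff_contractAt (w : Finset (Fin n) → MvPolynomial (Fin n) K) :
    fullKoszulDiff (fun s => contractAt hd s (w s)) s = contractAt hd s (fullKoszulDiff w s) := by
  rw [fullKoszulDiff, fullKoszulDiff, contractAt_sum]
  refine Finset.sum_congr rfl fun t ht => ?_
  rw [contractAt_koszulSign_mul, contractAt_X_mul hd s (Finset.mem_compl.1 ht)]

end contractAt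

/-- The map of Koszul chains `e_s ⊗ f ↦ e_s ⊗ x_s ^ (d - 1) α(f)`. -/
noncomputable def expandChain {n : ℕ} (d : ℕ) (z : Finset (Fin n) → MvPolynomial (Fin n) K)
    (s : Finset (Fin n)) : MvPolynomial (Fin n) K :=
  monomial (subsetExponent d s) 1 * aeval (fun i => (X i : MvPolynomial (Fin n) K) ^ d) (z s)

lemma fullKoszulDiff_expandChain {n d : ℕ} (hd : 0 < d)
    (z : Finset (Fin n) → MvPolynomial (Fin n) K) :
    fullKoszulDiff (expandChain d z) = expandChain d (fullKoszulDiff z) := by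
  ext1 s
  rw [expandChain, fullKoszulDiff, fullKoszulDiff, map_sum, Finset.mul_sum]
  refine Finset.sum_congr rfl fun t ht => ?_
  rw [Finset.mem_compl] at ht
  have h1 : (X t * monomial (subsetExponent d (insert t s)) 1 : MvPolynomial (Fin n) K) =
      monomial (subsetExponent d s) 1 * X t ^ d := by
    rw [X_pow_eq_monomial, X, monomial_mul, monomial_mul]
    congr 2
    ext u
    by_cases hu : t = u
    · subst hu
      simp [subsetExponent_apply, ht]
      omega
    · simp [subsetExponent_apply, Ne.symm hu]
  have h2 : aeval (fun i => (X i : MvPolynomial (Fin n) K) ^ d) (koszulSign s t : MvPolynomial (Fin n) K) =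
      koszulSign s t := by
    simp [koszulSign]
  rw [map_mul, map_mul, aeval_X, h2, expandChain]
  linear_combination koszulSign s t *
    aeval (fun i => (X i : MvPolynomial (Fin n) K) ^ d) (z (insert t s)) * h1

lemma contractAt_expandChain {n d : ℕ} (hd : 0 < d)
    (z : Finset (Fin n) → MvPolynomial (Fin n) K) (s : Finset (Fin n)) :
    contractAt hd s (expandChain d z s) = z s := by
  rw [expandChain, contractAt_mul_aeval, contractAt_monomial_subsetExponent, one_mul]

lemma expandChain_mem_idealPiece {n : ℕ} {d : ℕ} (hd : 0 < d)
    {I : Ideal (MvPolynomial (Fin n) K)} {z : Finset (Fin n) → MvPolynomial (Fin n) K}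
    {s : Finset (Fin n)} {j : ℤ} (hz : z s ∈ idealPiece I (j - s.card)) :
    expandChain d z s ∈ idealPiece (I.map (aeval (fun i => (X i : MvPolynomial (Fin n) K) ^ d) :
      MvPolynomial (Fin n) K →ₐ[K] MvPolynomial (Fin n) K)) (d * j - s.card) := by
  by_cases hk : 0 ≤ j - s.card
  · have hz' := mem_idealPiece_iff.1 hz
    rw [idealPiece, if_pos hk] at hz
    have h1 : (expandChain d z s).IsHomogeneous
        ((d - 1) * s.card + d * (j - s.card).toNat) :=
      (isHomogeneous_monomial _ (degree_subsetExponent d s)).mul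
        (IsHomogeneous.aeval hz.2 _ fun i => isHomogeneous_X_pow i d)
    rw [mem_idealPiece_iff]
    refine ⟨Ideal.mul_mem_left _ _ (Ideal.mem_map_of_mem _ hz'.1), fun b hb => ?_⟩
    have h2 : b.degree = _ := not_not.1 (h1.coeff_eq_zero.mt hb)
    rw [h2]
    push_cast [Nat.cast_sub hd, Int.toNat_of_nonneg hk]
    ring
  · rw [idealPiece, if_neg hk, Submodule.mem_bot] at hz
    rw [expandChain, hz, map_zero, mul_zero]
    exact Submodule.zero_mem _

lemma extendChain_of_card_ne {n : ℕ} {I : Ideal (MvPolynomial (Fin n) K)} {i : ℕ} {k : ℤ}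
    (z : KoszulIdx n i → idealPiece I k) {s : Finset (Fin n)} (hs : s.card ≠ i) :
    extendChain z s = 0 :=
  dif_neg hs

lemma gradedBetti_map_ne_zero {n d : ℕ} (hd : 0 < d) {I : Ideal (MvPolynomial (Fin n) K)} {i : ℕ}
    {j : ℤ} (h : gradedBetti I i j ≠ 0) :
    gradedBetti (I.map (aeval (fun i => (X i : MvPolynomial (Fin n) K) ^ d) :
      MvPolynomial (Fin n) K →ₐ[K] MvPolynomial (Fin n) K)) i (d * j) ≠ 0 := by
  rw [gradedBetti_ne_zero_iff] at h ⊢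
  obtain ⟨z, hz, hzr⟩ := h
  have hmem : ∀ s : KoszulIdx n i, expandChain d (extendChain z) s.1 ∈
      idealPiece (I.map (aeval (fun i => (X i : MvPolynomial (Fin n) K) ^ d) :
        MvPolynomial (Fin n) K →ₐ[K] MvPolynomial (Fin n) K)) (d * j - (i : ℕ)) := by
    rintro ⟨s, rfl⟩
    exact expandChain_mem_idealPiece hd (extendChain_mem z s)
  have hext : extendChain (fun s => ⟨_, hmem s⟩) = expandChain d (extendChain z) := by
    ext1 s
    by_cases hs : s.card = i
    · exact extendChain_apply _ ⟨s, hs⟩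
    · rw [extendChain_of_card_ne _ hs, expandChain, extendChain_of_card_ne _ hs, map_zero, mul_zero]
  refine ⟨fun s => ⟨_, hmem s⟩, ?_, fun hr => hzr ?_⟩
  · rw [mem_koszulCycles_iff] at hz ⊢
    rw [hext, fullKoszulDiff_expandChain hd, hz]
    ext1 s
    simp [expandChain]
  · rw [mem_range_koszulDiff_iff] at hr ⊢
    obtain ⟨w, hw, hwz⟩ := hr
    refine ⟨fun s => contractAt hd s (w s), fun s hs => ?_, fun s hs => ?_⟩
    · rw [← hs]
      exact contractAt_mem_idealPiece hd s (by rw [hs]; exact hw s hs)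
    · rw [fullKoszulDiff_contractAt, hwz s hs, hext, contractAt_expandChain]

/-- `fullKoszulDiff` as a linear map over the polynomial ring. -/
noncomputable def fullKoszulDiffLinear (n : ℕ) (K : Type) [Field K] :
    (Finset (Fin n) → MvPolynomial (Fin n) K) →ₗ[MvPolynomial (Fin n) K]
      (Finset (Fin n) → MvPolynomial (Fin n) K) where
  toFun := fullKoszulDiff
  map_add' x y := by
    ext1 s
    simp only [fullKoszulDiff, Pi.add_apply, ← Finset.sum_add_distrib]
    exact Finset.sum_congr rfl fun t _ => by ring
  map_smul' a x := by
    ext1 s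
    simp only [fullKoszulDiff, Pi.smul_apply, smul_eq_mul, Finset.mul_sum, RingHom.id_apply]
    exact Finset.sum_congr rfl fun t _ => by ring

/-- The Koszul chains with coefficients in an ideal. -/
noncomputable def idealChains {n : ℕ} (J : Ideal (MvPolynomial (Fin n) K)) :
    Submodule (MvPolynomial (Fin n) K) (Finset (Fin n) → MvPolynomial (Fin n) K) :=
  Submodule.pi Set.univ fun _ => J

lemma mem_idealChains {n : ℕ} {J : Ideal (MvPolynomial (Fin n) K)}
    {z : Finset (Fin n) → MvPolynomial (Fin n) K} : z ∈ idealChains J ↔ ∀ s, z s ∈ J := by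
  simp [idealChains, Submodule.mem_pi]

/-- Exterior multiplication by the `t`-th basis vector on Koszul chains. -/
noncomputable def koszulWedge {n : ℕ} (t : Fin n) (z : Finset (Fin n) → MvPolynomial (Fin n) K)
    (s : Finset (Fin n)) : MvPolynomial (Fin n) K :=
  if t ∈ s then koszulSign s t * z (s.erase t) else 0

lemma koszulSign_mul_self {n : ℕ} (s : Finset (Fin n)) (t : Fin n) :
    (koszulSign s t * koszulSign s t : MvPolynomial (Fin n) K) = 1 := by
  rw [koszulSign, ← mul_pow]
  simp

lemma koszulSign_erase_self {n : ℕ} (s : Finset (Fin n)) (t : Fin n) :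
    (koszulSign (s.erase t) t : MvPolynomial (Fin n) K) = koszulSign s t := by
  rw [koszulSign, koszulSign, Finset.filter_erase, Finset.erase_eq_of_notMem (by simp)]

lemma koszulSign_insert_self {n : ℕ} (s : Finset (Fin n)) (t : Fin n) :
    (koszulSign (insert t s) t : MvPolynomial (Fin n) K) = koszulSign s t := by
  rw [koszulSign, koszulSign, Finset.filter_insert, if_neg (lt_irrefl t)]

lemma koszulSign_swap {n : ℕ} {s : Finset (Fin n)} {t u : Fin n} (ht : t ∈ s) (hu : u ∉ s) :
    (koszulSign s u * koszulSign (insert u s) t : MvPolynomial (Fin n) K) =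
      -(koszulSign s t * koszulSign (s.erase t) u) := by
  have hne : u ≠ t := fun h => hu (h ▸ ht)
  simp only [koszulSign, Finset.filter_insert, Finset.filter_erase]
  rcases lt_or_gt_of_ne hne with h | h
  · rw [if_pos h, Finset.card_insert_of_notMem (by simp [hu]),
      Finset.erase_eq_of_notMem (by simp [h.le])]
    ring
  · rw [if_neg h.not_gt, ← Finset.card_erase_add_one (a := t) (s := s.filter (· < u))
      (by simp [ht, h])]
    ring

lemma fullKoszulDiff_koszulWedge {n : ℕ} (t : Fin n)
    (z : Finset (Fin n) → MvPolynomial (Fin n) K) :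
    fullKoszulDiff (koszulWedge t z) + koszulWedge t (fullKoszulDiff z) =
      (X t : MvPolynomial (Fin n) K) • z := by
  ext1 s
  rw [Pi.add_apply, Pi.smul_apply, smul_eq_mul]
  by_cases ht : t ∈ s
  · have h1 : koszulWedge t (fullKoszulDiff z) s = X t * z s +
        ∑ u ∈ sᶜ, koszulSign s t *
          (koszulSign (s.erase t) u * (X u * z (insert u (s.erase t)))) := by
      rw [koszulWedge, if_pos ht, fullKoszulDiff, Finset.compl_erase,
        Finset.sum_insert (by simpa using ht), Finset.insert_erase ht, mul_add, Finset.mul_sum,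
        koszulSign_erase_self]
      linear_combination X t * z s * koszulSign_mul_self (K := K) s t
    rw [h1, add_left_comm, fullKoszulDiff, ← Finset.sum_add_distrib, add_eq_left]
    refine Finset.sum_eq_zero fun u hu => ?_
    rw [Finset.mem_compl] at hu
    have hne : u ≠ t := fun h => hu (h ▸ ht)
    rw [koszulWedge, if_pos (Finset.mem_insert_of_mem ht), Finset.erase_insert_of_ne hne]
    linear_combination X u * z (insert u (s.erase t)) * koszulSign_swap (K := K) ht hu
  · have h1 : koszulWedge t (fullKoszulDiff z) s = 0 := if_neg ht
    rw [h1, add_zero, fullKoszulDiff, Finset.sum_eq_single t]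
    · rw [koszulWedge, if_pos (Finset.mem_insert_self t s), Finset.erase_insert ht,
        koszulSign_insert_self]
      linear_combination X t * z s * koszulSign_mul_self (K := K) s t
    · intro u _ hne
      rw [koszulWedge, if_neg (by simp [ht, hne.symm]), mul_zero, mul_zero]
    · simp [ht]

lemma X_smul_mem_map_of_cycle {n : ℕ} {J : Ideal (MvPolynomial (Fin n) K)}
    {z : Finset (Fin n) → MvPolynomial (Fin n) K} (hz : z ∈ idealChains J)
    (hd : fullKoszulDiff z = 0) (t : Fin n) :
    (X t : MvPolynomial (Fin n) K) • z ∈ (idealChains J).map (fullKoszulDiffLinear n K) := by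
  refine ⟨koszulWedge t z, mem_idealChains.2 fun s => ?_, ?_⟩
  · rw [koszulWedge]
    split_ifs
    · exact J.mul_mem_left _ (mem_idealChains.1 hz _)
    · exact J.zero_mem
  · rw [← fullKoszulDiff_koszulWedge, hd]
    ext1 s
    simp [koszulWedge, fullKoszulDiffLinear]

lemma sub_C_smul_mem_map_of_cycle {n : ℕ} {J : Ideal (MvPolynomial (Fin n) K)}
    {z : Finset (Fin n) → MvPolynomial (Fin n) K} (hz : z ∈ idealChains J)
    (hd : fullKoszulDiff z = 0) (f : MvPolynomial (Fin n) K) :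
    (f - C (constantCoeff f)) • z ∈ (idealChains J).map (fullKoszulDiffLinear n K) := by
  induction f using MvPolynomial.induction_on with
  | C a => simp
  | add p q hp hq =>
    have := add_mem hp hq
    rwa [← add_smul, sub_add_sub_comm, ← C_add, ← map_add] at this
  | mul_X p t _ =>
    rw [map_mul, constantCoeff_X, mul_zero, C_0, sub_zero, mul_smul]
    exact Submodule.smul_mem _ _ (X_smul_mem_map_of_cycle hz hd t)

lemma exists_totalDegree_bound_cycle {n : ℕ} (J : Ideal (MvPolynomial (Fin n) K)) :
    ∃ N : ℕ, ∀ z ∈ idealChains J, fullKoszulDiff z = 0 →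
      ∃ y : Finset (Fin n) → MvPolynomial (Fin n) K, ∃ w ∈ idealChains J,
        (∀ s, (y s).totalDegree ≤ N) ∧ z = y + fullKoszulDiff w := by
  obtain ⟨S, hS⟩ := IsNoetherian.noetherian
    (idealChains J ⊓ LinearMap.ker (fullKoszulDiffLinear n K))
  set N := S.sup fun z => Finset.univ.sup fun s => (z s).totalDegree with hN
  refine ⟨N, fun z hz hd => ?_⟩
  have hle : Submodule.span K (S : Set (Finset (Fin n) → MvPolynomial (Fin n) K)) ≤
      (idealChains J ⊓ LinearMap.ker (fullKoszulDiffLinear n K)).restrictScalars K := by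
    rw [← hS]
    exact Submodule.span_le_restrictScalars _ _ _
  have hdeg : Submodule.span K (S : Set (Finset (Fin n) → MvPolynomial (Fin n) K)) ≤
      Submodule.pi Set.univ fun _ => restrictTotalDegree (Fin n) K N := by
    rw [Submodule.span_le]
    intro x hx s _
    rw [SetLike.mem_coe, mem_restrictTotalDegree]
    exact (Finset.le_sup (f := fun s => (x s).totalDegree) (Finset.mem_univ s)).trans
      (Finset.le_sup (f := fun z : Finset (Fin n) → MvPolynomial (Fin n) K =>
        Finset.univ.sup fun s => (z s).totalDegree) hx)
  have key : ∃ y ∈ Submodule.span K (S : Set (Finset (Fin n) → MvPolynomial (Fin n) K)),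
      z - y ∈ (idealChains J).map (fullKoszulDiffLinear n K) := by
    have hzS : z ∈ Submodule.span (MvPolynomial (Fin n) K)
        (S : Set (Finset (Fin n) → MvPolynomial (Fin n) K)) := by
      rw [hS]
      exact ⟨hz, hd⟩
    clear hz hd
    induction hzS using Submodule.span_induction with
    | mem x hx => exact ⟨x, Submodule.subset_span hx, by simp⟩
    | zero => exact ⟨0, Submodule.zero_mem _, by simp⟩
    | add x x' _ _ hx hx' =>
      obtain ⟨y, hy, h⟩ := hx
      obtain ⟨y', hy', h'⟩ := hx'
      refine ⟨y + y', add_mem hy hy', ?_⟩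
      rw [add_sub_add_comm]
      exact add_mem h h'
    | smul a x _ hx =>
      obtain ⟨y, hy, h⟩ := hx
      refine ⟨constantCoeff a • y, Submodule.smul_mem _ _ hy, ?_⟩
      have hsub := add_mem (Submodule.smul_mem _ a h)
        (sub_C_smul_mem_map_of_cycle (hle hy).1 (hle hy).2 a)
      convert hsub using 1
      ext1 s
      simp only [Pi.sub_apply, Pi.smul_apply, Pi.add_apply, smul_eq_mul, smul_eq_C_mul]
      ring
  obtain ⟨y, hy, w, hw, hwz⟩ := key
  refine ⟨y, w, hw, fun s => ?_, ?_⟩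
  · exact (mem_restrictTotalDegree _ _ _).1 (hdeg hy s (Set.mem_univ s))
  · rw [show fullKoszulDiff w = z - y from hwz]
    abel

lemma homogeneousComponent_succ_X_mul {n : ℕ} (k : ℕ) (t : Fin n) (f : MvPolynomial (Fin n) K) :
    homogeneousComponent (k + 1) (X t * f) = X t * homogeneousComponent k f := by
  ext c
  rw [coeff_homogeneousComponent, coeff_X_mul', coeff_X_mul', coeff_homogeneousComponent]
  by_cases hc : t ∈ c.support
  · have hle : Finsupp.single t 1 ≤ c := by
      rw [Finsupp.single_le_iff]
      rw [Finsupp.mem_support_iff] at hc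
      omega
    have h : c.degree = (c - Finsupp.single t 1).degree + 1 := by
      conv_lhs => rw [← tsub_add_cancel_of_le hle]
      simp
    simp only [if_pos hc, h, Nat.add_right_cancel_iff]
  · simp [hc]

lemma homogeneousComponent_succ_fullKoszulDiff {n : ℕ} (k : ℕ)
    (w : Finset (Fin n) → MvPolynomial (Fin n) K) (s : Finset (Fin n)) :
    homogeneousComponent (k + 1) (fullKoszulDiff w s) =
      fullKoszulDiff (fun s => homogeneousComponent k (w s)) s := by
  rw [fullKoszulDiff, fullKoszulDiff, map_sum]
  refine Finset.sum_congr rfl fun t _ => ?_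
  have : (koszulSign s t : MvPolynomial (Fin n) K) =
      C ((-1) ^ (s.filter (· < t)).card) := by simp [koszulSign]
  rw [this, homogeneousComponent_C_mul, homogeneousComponent_succ_X_mul]

lemma exists_bound_gradedBetti {n : ℕ} {J : Ideal (MvPolynomial (Fin n) K)}
    (hJ : IsHomogeneousIdeal J) :
    ∃ N : ℕ, ∀ (i : ℕ) (j : ℤ), gradedBetti J i j ≠ 0 → j - i ≤ N := by
  obtain ⟨N, hN⟩ := exists_totalDegree_bound_cycle J
  refine ⟨N, fun i j h => ?_⟩
  by_contra! hlt
  obtain ⟨z, hz, hzr⟩ := gradedBetti_ne_zero_iff.1 h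
  obtain ⟨y, w, hw, hy, hzw⟩ := hN (extendChain z)
    (mem_idealChains.2 fun s => (mem_idealPiece_iff.1 (extendChain_mem z s)).1)
    (mem_koszulCycles_iff.1 hz)
  obtain ⟨k, hk⟩ : ∃ k : ℕ, j - i = (k + 1 : ℕ) := ⟨(j - i - 1).toNat, by omega⟩
  refine hzr (mem_range_koszulDiff_iff.2
    ⟨fun s => homogeneousComponent k (w s), fun s _ => ?_, fun s _ => ?_⟩)
  · rw [mem_idealPiece_iff]
    refine ⟨hJ _ (mem_idealChains.1 hw s) k, fun b hb => ?_⟩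
    have := not_not.1 ((homogeneousComponent_isHomogeneous k (w s)).coeff_eq_zero.mt hb)
    omega
  · have hzs : homogeneousComponent (k + 1) (extendChain z s) = extendChain z s := by
      refine homogeneousComponent_eq_self ?_
      have hs : extendChain z s ∈ idealPiece J (k + 1 : ℕ) := hk ▸ extendChain_mem z s
      rw [idealPiece, if_pos (by omega)] at hs
      exact hs.2
    rw [← homogeneousComponent_succ_fullKoszulDiff, ← hzs, hzw, Pi.add_apply, map_add,
      homogeneousComponent_eq_zero (k + 1) (y s) (by have := hy s; omega), zero_add]

lemma sub_nonneg_of_gradedBetti_ne_zero {n : ℕ} {J : Ideal (MvPolynomial (Fin n) K)} {i : ℕ}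
    {j : ℤ} (h : gradedBetti J i j ≠ 0) : 0 ≤ j - i := by
  by_contra hlt
  obtain ⟨z, -, hzr⟩ := gradedBetti_ne_zero_iff.1 h
  have hz : z = 0 := by
    ext1 s
    have hbot : idealPiece J (j - i) = ⊥ := by rw [idealPiece, if_neg hlt]
    exact Subtype.ext ((Submodule.mem_bot K).1 (hbot.le (z s).2))
  exact hzr (hz ▸ Submodule.zero_mem _)

lemma reg_nonneg {n : ℕ} (J : Ideal (MvPolynomial (Fin n) K)) : 0 ≤ reg J := by
  rw [reg]
  set S := {r : ℤ | ∃ (i : ℕ) (j : ℤ), gradedBetti J i j ≠ 0 ∧ r = j - i}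
  by_cases hS : S.Nonempty ∧ BddAbove S
  · obtain ⟨i, j, hij, h⟩ := Int.csSup_mem hS.1 hS.2
    rw [h]
    exact sub_nonneg_of_gradedBetti_ne_zero hij
  · rcases not_and_or.1 hS with h | h
    · rw [Set.not_nonempty_iff_eq_empty.1 h, Int.csSup_empty]
    · rw [Int.csSup_of_not_bddAbove h]

lemma le_reg {n : ℕ} {J : Ideal (MvPolynomial (Fin n) K)} (hJ : IsHomogeneousIdeal J) {i : ℕ}
    {j : ℤ} (h : gradedBetti J i j ≠ 0) : j - i ≤ reg J := by
  obtain ⟨N, hN⟩ := exists_bound_gradedBetti hJ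
  refine le_csSup ⟨N, ?_⟩ ⟨i, j, h, rfl⟩
  rintro _ ⟨i, j, hij, rfl⟩
  exact hN i j hij

lemma gradedBetti_maxShift_ne_zero {n : ℕ} {J : Ideal (MvPolynomial (Fin n) K)}
    (hJ : IsHomogeneousIdeal J) {i : ℕ} (h : ∃ j, gradedBetti J i j ≠ 0) :
    gradedBetti J i (maxShift J i) ≠ 0 := by
  obtain ⟨N, hN⟩ := exists_bound_gradedBetti hJ
  refine Int.csSup_mem (s := {j : ℤ | gradedBetti J i j ≠ 0}) h ⟨N + i, fun j hj => ?_⟩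
  have := hN i j hj
  omega

lemma IsHomogeneousIdeal.map_aeval_X_pow {n : ℕ} {I : Ideal (MvPolynomial (Fin n) K)}
    (hI : IsHomogeneousIdeal I) (d : ℕ) :
    IsHomogeneousIdeal (I.map (aeval (fun i => (X i : MvPolynomial (Fin n) K) ^ d) :
      MvPolynomial (Fin n) K →ₐ[K] MvPolynomial (Fin n) K)) := by
  let _ : GradedAlgebra (homogeneousSubmodule (Fin n) K) := gradedAlgebra
  set α : MvPolynomial (Fin n) K →ₐ[K] MvPolynomial (Fin n) K :=
    aeval (fun i => (X i : MvPolynomial (Fin n) K) ^ d)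
  have hspan : I.map α = Ideal.span (α '' {f | f ∈ I ∧ ∃ k, f.IsHomogeneous k}) := by
    apply le_antisymm
    · rw [Ideal.map_le_iff_le_comap]
      intro f hf
      rw [Ideal.mem_comap, ← sum_homogeneousComponent f, map_sum]
      exact Ideal.sum_mem _ fun k _ => Ideal.subset_span ⟨_, ⟨hI f hf k, k,
        homogeneousComponent_isHomogeneous k f⟩, rfl⟩
    · rw [Ideal.span_le]
      rintro _ ⟨f, hf, rfl⟩
      exact Ideal.mem_map_of_mem _ hf.1
  have hhom : (I.map α).IsHomogeneous (homogeneousSubmodule (Fin n) K) := by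
    rw [hspan]
    refine Ideal.homogeneous_span _ _ ?_
    rintro _ ⟨f, ⟨-, k, hk⟩, rfl⟩
    exact ⟨_, hk.aeval _ fun i => isHomogeneous_X_pow i d⟩
  intro f hf k
  exact homogeneousComponent_mem_of_mem hhom hf k

/-- Let `α : R → R` be the `K`-algebra map of `R = K[x_1,…,x_n]` with `α(x_i) = x_i^d`,
`d > 0`, and `I' = α(I)R` for a homogeneous ideal `I`.  If `p` is the largest integer `i`
with `reg(I) = t_i(I) - i`, then `reg(I') ≥ d·reg(I) + p(d-1)`. -/
theorem reg_power_map_ge {n : ℕ} (d : ℕ) (hd : 0 < d)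
    (I : Ideal (MvPolynomial (Fin n) K)) (hI : IsHomogeneousIdeal I)
    (p : ℕ) (hp : IsGreatest {i : ℕ | reg I = maxShift I i - i} p) :
    reg (Ideal.map
        (aeval (fun i => (X i : MvPolynomial (Fin n) K) ^ d) :
          MvPolynomial (Fin n) K →ₐ[K] MvPolynomial (Fin n) K) I) ≥
      d * reg I + p * (d - 1) := by
  by_cases h : ∃ j, gradedBetti I p j ≠ 0
  · have hle := le_reg (hI.map_aeval_X_pow d)
      (gradedBetti_map_ne_zero hd (gradedBetti_maxShift_ne_zero hI h))
    have hreg : reg I = maxShift I p - p := hp.1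
    rw [ge_iff_le, hreg]
    refine le_trans (le_of_eq ?_) hle
    ring
  · have hempty : {j : ℤ | gradedBetti I p j ≠ 0} = ∅ :=
      Set.eq_empty_iff_forall_notMem.2 fun j hj => h ⟨j, hj⟩
    have hreg : reg I = maxShift I p - p := hp.1
    rw [maxShift, hempty, Int.csSup_empty] at hreg
    have hnonneg := reg_nonneg I
    have hp0 : (p : ℤ) = 0 := by omega
    have hr0 : reg I = 0 := by omega
    rw [hp0, hr0, mul_zero, zero_mul, add_zero]
    exact reg_nonneg _
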